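/- Let p ≥ 3 be an integer and let f = (f_{i,j}) be an infinite frieze pattern of type Λ_p. Then there are no integers i < j < k < ℓ with f_{i,k} = 1 and f_{j,ℓ} = 1; that is, the arcs (i,j) with j ≥ i+2 and f_{i,j} = 1 are pairwise non-crossing. -/

import Mathlib

/-- `lam p = λ_p = 2 cos (π / p)`. -/
noncomputable def lam (p : ℕ) : ℝ := 2 * Real.cos (Real.pi / p)

/-- An infinite frieze pattern. -/
def IsInfFrieze (f : ℤ → ℤ → ℝ) : Prop :=
  (∀ i : ℤ, f i i = 0) ∧
  (∀ i : ℤ, f i (i + 1) = 1) ∧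
  (∀ i j : ℤ, i + 1 ≤ j → 0 < f i j) ∧
  (∀ i j : ℤ, i + 1 ≤ j → f i j * f (i + 1) (j + 1) - f i (j + 1) * f (i + 1) j = 1)

/-- The frieze pattern is of type `Λ_p`. -/
def IsTypeLambda (p : ℕ) (f : ℤ → ℤ → ℝ) : Prop :=
  ∀ i : ℤ, ∃ n : ℕ, 0 < n ∧ f i (i + 2) = n * lam p

/-- `s_k = sin(kπ/p)/sin(π/p)`. -/
noncomputable def ss (p k : ℕ) : ℝ := Real.sin (k * (Real.pi / p)) / Real.sin (Real.pi / p)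

lemma sin_base_pos (p : ℕ) (hp : 3 ≤ p) : 0 < Real.sin (Real.pi / p) := by
  have hp' : (3 : ℝ) ≤ p := by exact_mod_cast hp
  apply Real.sin_pos_of_pos_of_lt_pi
  · have := Real.pi_pos
    positivity
  · rw [div_lt_iff₀ (by linarith)]
    nlinarith [Real.pi_pos]

lemma ss_zero (p : ℕ) : ss p 0 = 0 := by simp [ss]

lemma ss_one (p : ℕ) (hp : 3 ≤ p) : ss p 1 = 1 := by
  have := sin_base_pos p hp
  simp [ss, this.ne']

lemma ss_p (p : ℕ) (hp : 3 ≤ p) : ss p p = 0 := by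
  have hp' : (p : ℝ) ≠ 0 := by
    have : p ≠ 0 := by omega
    exact_mod_cast this
  have : (p : ℝ) * (Real.pi / p) = Real.pi := by field_simp
  simp [ss, this]

lemma ss_rec (p k : ℕ) : ss p (k + 2) = lam p * ss p (k + 1) - ss p k := by
  unfold ss lam
  have h1 : ((k + 2 : ℕ) : ℝ) * (Real.pi / p) = ((k + 1 : ℕ) : ℝ) * (Real.pi / p) + Real.pi / p := by
    push_cast; ring
  have h2 : (k : ℝ) * (Real.pi / p) = ((k + 1 : ℕ) : ℝ) * (Real.pi / p) - Real.pi / p := by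
    push_cast; ring
  rw [h1, h2, Real.sin_add, Real.sin_sub]
  ring

lemma ss_ge_one (p : ℕ) (hp : 3 ≤ p) (k : ℕ) (h1 : 1 ≤ k) (h2 : k + 1 ≤ p) : 1 ≤ ss p k := by
  unfold ss
  rw [le_div_iff₀ (sin_base_pos p hp), one_mul]
  have hp' : (3 : ℝ) ≤ p := by exact_mod_cast hp
  have h1' : (1 : ℝ) ≤ k := by exact_mod_cast h1
  have h2' : (k : ℝ) + 1 ≤ p := by exact_mod_cast h2
  set t := Real.pi / p with ht
  have htp : (p : ℝ) * t = Real.pi := by rw [ht]; field_simp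
  have ht0 : 0 < t := by
    have := Real.pi_pos
    positivity
  by_cases h : (k : ℝ) * t ≤ Real.pi / 2
  · apply Real.sin_le_sin_of_le_of_le_pi_div_two <;> nlinarith
  · rw [← Real.sin_pi_sub (k * t)]
    apply Real.sin_le_sin_of_le_of_le_pi_div_two <;> nlinarith

/-- zero or at least one -/
def ZO (x : ℝ) : Prop := x = 0 ∨ 1 ≤ x

lemma ZO.add {x y : ℝ} (hx : ZO x) (hy : ZO y) : ZO (x + y) := by
  rcases hx with rfl | hx <;> rcases hy with rfl | hy
  · left; simp
  · right; simpa using hy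
  · right; simpa using hx
  · right; linarith

lemma ZO.mul {x y : ℝ} (hx : ZO x) (hy : ZO y) : ZO (x * y) := by
  rcases hx with rfl | hx
  · left; simp
  rcases hy with rfl | hy
  · left; simp
  · right; nlinarith

lemma ss_ZO (p : ℕ) (hp : 3 ≤ p) (k : ℕ) (h2 : k ≤ p) : ZO (ss p k) := by
  by_cases h0 : k = 0
  · subst h0; exact Or.inl (ss_zero p)
  by_cases hk : k = p
  · subst hk; exact Or.inl (ss_p k hp)
  · exact Or.inr (ss_ge_one p hp k (by omega) (by omega))

/-- rows of products of the nonnegative matrices `V_k` -/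
inductive NN (p : ℕ) : ℝ → ℝ → Prop
  | e1 : NN p 1 0
  | e2 : NN p 0 1
  | step (x y : ℝ) (k : ℕ) (hk : k + 2 ≤ p) (h : NN p x y) :
      NN p (x * ss p (k + 1) + y * ss p k) (x * ss p (k + 2) + y * ss p (k + 1))

lemma NN.zo {p : ℕ} (hp : 3 ≤ p) {x y : ℝ} (h : NN p x y) : ZO x ∧ ZO y := by
  induction h with
  | e1 => exact ⟨Or.inr le_rfl, Or.inl rfl⟩
  | e2 => exact ⟨Or.inl rfl, Or.inr le_rfl⟩
  | step x y k hk h ih =>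
    have a := ss_ZO p hp k (by omega)
    have b := ss_ZO p hp (k + 1) (by omega)
    have c := ss_ZO p hp (k + 2) (by omega)
    obtain ⟨u, v⟩ := ih
    exact ⟨ZO.add (ZO.mul u b) (ZO.mul v a), ZO.add (ZO.mul u c) (ZO.mul v b)⟩

def GG (p : ℕ) (x y : ℝ) : Prop := NN p x y ∨ NN p (-x) (-y) ∨ NN p (-y) x ∨ NN p y (-x)

lemma GG.neg {p : ℕ} {x y : ℝ} (h : GG p x y) : GG p (-x) (-y) := by
  unfold GG at *
  simp only [neg_neg]
  tauto

lemma GG.rot {p : ℕ} {x y : ℝ} (h : GG p x y) : GG p y (-x) := by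
  unfold GG at *
  simp only [neg_neg]
  tauto

lemma NN.T {p : ℕ} (hp : 3 ≤ p) {x y : ℝ} (h : NN p x y) : NN p x (y + lam p * x) := by
  have := NN.step x y 0 (by omega) h
  rw [ss_rec, ss_zero, zero_add, ss_one p hp] at this
  convert this using 1 <;> ring

lemma NN.ST {p : ℕ} (hp : 3 ≤ p) {x y : ℝ} (h : NN p x y) : GG p y (-x + lam p * y) := by
  cases h with
  | e1 =>
    have : GG p 1 0 := Or.inl NN.e1
    simpa using this.rot
  | e2 =>
    have : NN p 1 (0 + lam p * 1) := NN.T hp NN.e1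
    left; simpa using this
  | step x y k hk h =>
    by_cases hk' : k + 3 ≤ p
    · left
      have := NN.step x y (k + 1) (by omega) h
      convert this using 1
      rw [show k + 1 + 2 = (k + 1) + 2 from rfl, ss_rec p (k + 1), show k + 1 + 1 = k + 2 from rfl,
        ss_rec p k]
      ring
    · have hk2 : k + 2 = p := by omega
      have h2 : ss p (k + 2) = 0 := by rw [hk2]; exact ss_p p hp
      have h3 := ss_rec p k
      have h4 := ss_rec p (k + 1)
      have h1 : ss p (k + 1) = 1 := by
        unfold ss
        have e : ((k + 1 : ℕ) : ℝ) * (Real.pi / p) = Real.pi - Real.pi / p := by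
          have hp' : (p : ℝ) ≠ 0 := by
            have : p ≠ 0 := by omega
            exact_mod_cast this
          have : ((k + 1 : ℕ) : ℝ) = p - 1 := by rw [← hk2]; push_cast; ring
          rw [this]; field_simp
        rw [e, Real.sin_pi_sub, div_self (sin_base_pos p hp).ne']
      have h5 : ss p k = lam p := by rw [h2, h1] at h3; linarith
      have g : GG p y (-x) := GG.rot (Or.inl h)
      rw [h2, h1, h5]
      convert g using 1 <;> ring

lemma GG.T {p : ℕ} (hp : 3 ≤ p) {x y : ℝ} (h : GG p x y) : GG p x (y + lam p * x) := by
  rcases h with h | h | h | h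
  · exact Or.inl (h.T hp)
  · have : GG p (-x) (-y + lam p * (-x)) := Or.inl (h.T hp)
    have := this.neg
    convert this using 1 <;> ring
  · have := h.ST hp
    convert this using 1; ring
  · have := (h.ST hp).neg
    convert this using 1 <;> ring

lemma GG.Tn {p : ℕ} (hp : 3 ≤ p) {x y : ℝ} (h : GG p x y) (n : ℕ) :
    GG p x (y + n * lam p * x) := by
  induction n with
  | zero => simpa using h
  | succ n ih =>
    have := ih.T hp
    convert this using 1
    push_cast; ring

lemma GG.pos {p : ℕ} (hp : 3 ≤ p) {x y : ℝ} (h : GG p x y) (hy : 0 < y) : 1 ≤ y := by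
  rcases h with h | h | h | h
  · rcases (h.zo hp).2 with h | h <;> linarith
  · rcases (h.zo hp).2 with h | h <;> linarith
  · rcases (h.zo hp).1 with h | h <;> linarith
  · rcases (h.zo hp).1 with h | h <;> linarith

lemma frieze_rec {f : ℤ → ℤ → ℝ} (hf : IsInfFrieze f) (n : ℕ) : ∀ i j : ℤ, i + n + 1 = j →
    f i (j + 1) + f i (j - 1) = f (j - 1) (j + 1) * f i j := by
  obtain ⟨h0, h1, hpos, hu⟩ := hf
  induction n with
  | zero =>
    intro i j h
    obtain rfl : i = j - 1 := by push_cast at h; omega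
    have := h1 (j - 1)
    rw [sub_add_cancel] at this
    rw [h0, this]; ring
  | succ n ih =>
    intro i j h
    push_cast at h
    have e := ih (i + 1) j (by omega)
    have u1 := hu i j (by omega)
    have u2 := hu i (j - 1) (by omega)
    rw [sub_add_cancel] at u2
    have hp := hpos (i + 1) j (by omega)
    apply mul_left_cancel₀ hp.ne'
    linear_combination u2 - u1 + f i j * e

lemma frieze_ge_one {p : ℕ} (hp : 3 ≤ p) {f : ℤ → ℤ → ℝ} (hf : IsInfFrieze f)
    (hl : IsTypeLambda p f) (i j : ℤ) (hij : i < j) : 1 ≤ f i j := by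
  have key : ∀ n : ℕ, GG p (f i (i + n)) (f i (i + n + 1)) := by
    intro n
    induction n with
    | zero =>
      simp only [Nat.cast_zero, add_zero, hf.1, hf.2.1]
      exact Or.inl NN.e2
    | succ n ih =>
      obtain ⟨m, -, hm⟩ := hl (i + n)
      have r := frieze_rec hf n i (i + n + 1) rfl
      rw [add_sub_cancel_right, show i + (n : ℤ) + 1 + 1 = i + n + 2 by ring, hm] at r
      have := ih.rot.Tn hp m
      push_cast
      rw [show i + ((n : ℤ) + 1) + 1 = i + n + 2 by ring, show i + ((n : ℤ) + 1) = i + n + 1 by ring]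
      convert this using 1
      linarith
  obtain ⟨n, hn⟩ := Int.eq_ofNat_of_zero_le (show 0 ≤ j - i - 1 by omega)
  have := key n
  rw [show i + (n : ℤ) + 1 = j by omega] at this
  exact this.pos hp (hf.2.2.1 i j (by omega))

lemma frieze_wronsk {f : ℤ → ℤ → ℝ} (hf : IsInfFrieze f) (i j : ℤ) (hij : i < j) (n : ℕ) :
    f i (j + n) * f j (j + n + 1) - f i (j + n + 1) * f j (j + n) = f i j := by
  induction n with
  | zero => simp [hf.1, hf.2.1]
  | succ n ih =>
    have r1 := frieze_rec hf n j (j + n + 1) rfl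
    have r2 := frieze_rec hf (n + (j - i).toNat) i (j + n + 1) (by push_cast; omega)
    rw [add_sub_cancel_right] at r1 r2
    push_cast
    rw [← add_assoc]
    linear_combination ih + f i (j + n + 1) * r1 - f j (j + n + 1) * r2

lemma frieze_ptolemy {f : ℤ → ℤ → ℝ} (hf : IsInfFrieze f) (i j k : ℤ) (hij : i < j) (hjk : j < k)
    (n : ℕ) : f i k * f j (k + n) - f i (k + n) * f j k = f i j * f k (k + n) ∧
      f i k * f j (k + n + 1) - f i (k + n + 1) * f j k = f i j * f k (k + n + 1) := by
  induction n with
  | zero =>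
    have := frieze_wronsk hf i j hij (k - j).toNat
    rw [show j + ((k - j).toNat : ℤ) = k by omega] at this
    simp only [Nat.cast_zero, add_zero, hf.1, hf.2.1]
    exact ⟨by ring, by linarith⟩
  | succ n ih =>
    have r0 := frieze_rec hf n k (k + n + 1) rfl
    have r1 := frieze_rec hf (n + (k - j).toNat) j (k + n + 1) (by push_cast; omega)
    have r2 := frieze_rec hf (n + (k - i).toNat) i (k + n + 1) (by push_cast; omega)
    rw [add_sub_cancel_right] at r0 r1 r2
    push_cast
    rw [← add_assoc]
    refine ⟨ih.2, ?_⟩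
    linear_combination f (k + n) (k + n + 1 + 1) * ih.2 - ih.1 + f i k * r1 - f j k * r2
      - f i j * r0

/-- The arcs `(i,j)` with `f i j = 1` are pairwise non-crossing: there are no
`i < j < k < ℓ` with `f i k = 1` and `f j ℓ = 1`. -/
theorem infFrieze_arcs_noncrossing (p : ℕ) (hp : 3 ≤ p) (f : ℤ → ℤ → ℝ)
    (hf : IsInfFrieze f) (hl : IsTypeLambda p f) :
    ¬ ∃ i j k l : ℤ, i < j ∧ j < k ∧ k < l ∧ f i k = 1 ∧ f j l = 1 := by
  rintro ⟨i, j, k, l, hij, hjk, hkl, h1, h2⟩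
  have P := (frieze_ptolemy hf i j k hij hjk (l - k).toNat).1
  rw [show k + ((l - k).toNat : ℤ) = l by omega, h1, h2] at P
  have a := frieze_ge_one hp hf hl i j hij
  have b := frieze_ge_one hp hf hl k l hkl
  have c := frieze_ge_one hp hf hl i l (by omega)
  have d := frieze_ge_one hp hf hl j k hjk
  nlinarith
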